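/- arXiv:1402.3279 — 2 statements merged into one kernel-verified Lean document; each statement's English description precedes it below -/
import Mathlib

section
/- Every (k,ε) spectral extractor is a quantum-proof (k, 2√ε) extractor: if {f_1,…,f_D} are functions from N to M such that the map ψ(P) = (1/D) Σ_i P_{f_i(N)} ⊗ |i⟩⟨i| satisfies λ_max(ψ†∘ψ − τ†∘τ) ≤ 2^k · ε/(|M|·|D|) with τ(P) = (Σ_j P_j)·u_M ⊗ u_D, then for every classical-quantum state ρ_{NR} with H_min(N|R)_ρ ≥ k one has ‖(1/D) Σ_i ρ_{f_i(N)R} ⊗ |i⟩⟨i| − u_M ⊗ ρ_R ⊗ u_D‖_1 ≤ 2√ε. -/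
open Matrix Finset
open scoped ComplexOrder

/-- Trace norm: the sum of the singular values of `A`. -/
noncomputable def traceNorm {n : Type} [Fintype n] [DecidableEq n] (A : Matrix n n ℂ) : ℝ :=
  ∑ i, Real.sqrt ((Matrix.posSemidef_conjTranspose_mul_self A).1.eigenvalues i)

/-- Partial trace over the first (the `N`) system. -/
noncomputable def ptraceFst {n r : Type} [Fintype n] [Fintype r]
    (A : Matrix (n × r) (n × r) ℂ) : Matrix r r ℂ :=
  Matrix.of fun a b => ∑ x : n, A (x, a) (x, b)

/-- Spectral function of a Hermitian matrix. -/
noncomputable def specFun {n : Type} [Fintype n] [DecidableEq n] {A : Matrix n n ℂ}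
    (hA : A.IsHermitian) (g : ℝ → ℝ) : Matrix n n ℂ :=
  (hA.eigenvectorUnitary : Matrix n n ℂ) * diagonal (fun i => ((g (hA.eigenvalues i) : ℝ) : ℂ)) *
    star (hA.eigenvectorUnitary : Matrix n n ℂ)

section spec
variable {n : Type} [Fintype n] [DecidableEq n] {A : Matrix n n ℂ}

lemma specFun_id (hA : A.IsHermitian) : specFun hA (fun t => t) = A := by
  conv_rhs => rw [hA.spectral_theorem, Unitary.conjStarAlgAut_apply]
  rfl

lemma specFun_mul (hA : A.IsHermitian) (g h : ℝ → ℝ) :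
    specFun hA g * specFun hA h = specFun hA (fun t => g t * h t) := by
  have hU : star (hA.eigenvectorUnitary : Matrix n n ℂ) * (hA.eigenvectorUnitary : Matrix n n ℂ) = 1 :=
    Unitary.coe_star_mul_self _
  unfold specFun
  generalize (hA.eigenvectorUnitary : Matrix n n ℂ) = U at *
  calc _ = U * diagonal (fun i => ((g (hA.eigenvalues i) : ℝ) : ℂ)) * (star U * U) *
        diagonal (fun i => ((h (hA.eigenvalues i) : ℝ) : ℂ)) * star U := by
        simp only [Matrix.mul_assoc]
    _ = _ := by
        rw [hU, Matrix.mul_one, Matrix.mul_assoc U, diagonal_mul_diagonal]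
        simp

lemma specFun_one (hA : A.IsHermitian) : specFun hA (fun _ => 1) = 1 := by
  simp [specFun]

lemma specFun_congr (hA : A.IsHermitian) (g h : ℝ → ℝ)
    (hgh : ∀ i, g (hA.eigenvalues i) = h (hA.eigenvalues i)) :
    specFun hA g = specFun hA h := by
  simp [specFun, hgh]

lemma specFun_herm (hA : A.IsHermitian) (g : ℝ → ℝ) : (specFun hA g)ᴴ = specFun hA g := by
  unfold specFun
  rw [conjTranspose_mul, conjTranspose_mul, diagonal_conjTranspose, star_eq_conjTranspose,
    conjTranspose_conjTranspose, Matrix.mul_assoc]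
  congr 3
  ext i
  simp

lemma specFun_trace (hA : A.IsHermitian) (g : ℝ → ℝ) :
    (specFun hA g).trace = ∑ i, ((g (hA.eigenvalues i) : ℝ) : ℂ) := by
  unfold specFun
  rw [Matrix.trace_mul_comm, ← Matrix.mul_assoc, Unitary.coe_star_mul_self, Matrix.one_mul,
    trace_diagonal]

lemma specFun_charpoly_roots (hA : A.IsHermitian) (g : ℝ → ℝ) :
    (specFun hA g).charpoly.roots =
      Multiset.map (fun i => ((g (hA.eigenvalues i) : ℝ) : ℂ)) Finset.univ.val := by
  unfold specFun
  rw [charpoly_mul_comm, ← Matrix.mul_assoc, Unitary.coe_star_mul_self, Matrix.one_mul,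
    charpoly_diagonal, Polynomial.roots_prod]
  · simp
  · simp [Finset.prod_ne_zero_iff, Polynomial.X_sub_C_ne_zero]

/-- For Hermitian `A` the trace norm is attained by a Hermitian unitary. -/
lemma traceNorm_eq (hA : A.IsHermitian) :
    ∃ S : Matrix n n ℂ, Sᴴ = S ∧ S * S = 1 ∧ traceNorm A = ((S * A).trace).re := by
  refine ⟨specFun hA (fun t => if 0 ≤ t then 1 else -1), specFun_herm _ _, ?_, ?_⟩
  · rw [specFun_mul, ← specFun_one hA]
    apply specFun_congr
    intro i
    split_ifs <;> simp
  · have h1 : (specFun hA (fun t => if 0 ≤ t then 1 else -1)) * A = specFun hA (fun t => |t|) := by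
      have h0 : ∀ B : Matrix n n ℂ, B * A = B * specFun hA (fun t => t) := fun B => by
        rw [specFun_id]
      rw [h0, specFun_mul]
      apply specFun_congr
      intro i
      split_ifs with h
      · simp [abs_of_nonneg h]
      · simp [abs_of_neg (not_le.mp h)]
    rw [h1, specFun_trace]
    have h2 : Aᴴ * A = specFun hA (fun t => t * t) := by
      rw [← specFun_mul, specFun_id, hA.eq]
    have h3 := (Matrix.posSemidef_conjTranspose_mul_self A).1.roots_charpoly_eq_eigenvalues
    have h4 := specFun_charpoly_roots hA (fun t => t * t)
    rw [← h2, h3] at h4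
    have h5 := congrArg (fun s => (Multiset.map (fun z : ℂ => Real.sqrt z.re) s).sum) h4
    simp only [Multiset.map_map, Function.comp_def] at h5
    unfold traceNorm
    simp only [← Complex.ofReal_sum, Complex.ofReal_re]
    have h6 : ∑ i, Real.sqrt
        (((((Matrix.posSemidef_conjTranspose_mul_self A).1.eigenvalues i : ℝ) : ℂ)).re) =
        ∑ i, Real.sqrt ((((hA.eigenvalues i * hA.eigenvalues i : ℝ) : ℂ)).re) := h5
    simp only [Complex.ofReal_re, Real.sqrt_mul_self_eq_abs] at h6
    exact h6
end spec

/-- Squared Frobenius norm. -/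
noncomputable def frob {n : Type} [Fintype n] (A : Matrix n n ℂ) : ℝ := ∑ i, ∑ j, ‖A i j‖ ^ 2

section frobs
variable {n : Type} [Fintype n]

lemma frob_nonneg (A : Matrix n n ℂ) : 0 ≤ frob A := by unfold frob; positivity

lemma frob_eq (A : Matrix n n ℂ) : frob A = ((Aᴴ * A).trace).re := by
  simp only [frob, Matrix.trace, Matrix.diag, Matrix.mul_apply, conjTranspose_apply, Complex.re_sum]
  rw [Finset.sum_comm]
  refine Finset.sum_congr rfl fun i _ => Finset.sum_congr rfl fun j _ => ?_
  rw [← Complex.normSq_eq_norm_sq]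
  simp [Complex.normSq_apply]

lemma frob_cs (A B : Matrix n n ℂ) : ((A * B).trace).re ≤ Real.sqrt (frob A) * Real.sqrt (frob B) := by
  have h1 : ((A * B).trace).re ≤ ∑ q : n × n, ‖A q.1 q.2‖ * ‖B q.2 q.1‖ := by
    simp only [Matrix.trace, Matrix.diag, Matrix.mul_apply, Complex.re_sum]
    rw [Fintype.sum_prod_type]
    refine Finset.sum_le_sum fun i _ => Finset.sum_le_sum fun j _ => ?_
    rw [← norm_mul]
    exact Complex.re_le_norm _
  refine h1.trans ((Real.sum_mul_le_sqrt_mul_sqrt _ _ _).trans (le_of_eq ?_))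
  unfold frob
  rw [Fintype.sum_prod_type, Fintype.sum_prod_type_right]

lemma frob_conj_bound [DecidableEq n] (S G : Matrix n n ℂ) (hS : Sᴴ = S) (hSS : S * S = 1) (hG : Gᴴ = G) :
    frob (G * S * G) ≤ ((G * G * (G * G)).trace).re := by
  have e1 : frob (G * S * G) = ((S * (G * G) * (S * (G * G))).trace).re := by
    rw [frob_eq]
    simp only [conjTranspose_mul, hS, hG]
    rw [show G * (S * G) * (G * S * G) = G * (S * (G * G) * S * G) by simp only [Matrix.mul_assoc],
      Matrix.trace_mul_comm]
    simp only [Matrix.mul_assoc]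
  rw [e1]
  refine (frob_cs _ _).trans (le_of_eq ?_)
  rw [Real.mul_self_sqrt (frob_nonneg _), frob_eq]
  simp only [conjTranspose_mul, hS, hG]
  rw [show G * G * S * (S * (G * G)) = G * G * (S * S) * (G * G) by simp only [Matrix.mul_assoc],
    hSS, Matrix.mul_one]
end frobs

/-- Block diagonal matrix, block index first. -/
def bdiag {o r : Type} [DecidableEq o] (F : o → Matrix r r ℂ) : Matrix (o × r) (o × r) ℂ :=
  Matrix.of fun a b => if a.1 = b.1 then F a.1 a.2 b.2 else 0

section bd
variable {o r : Type} [DecidableEq o]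

lemma bdiag_mul [Fintype o] [Fintype r] (F G : o → Matrix r r ℂ) :
    bdiag F * bdiag G = bdiag (fun x => F x * G x) := by
  ext ⟨x, a⟩ ⟨y, b⟩
  simp only [bdiag, Matrix.mul_apply, of_apply, Fintype.sum_prod_type]
  by_cases h : x = y
  · subst h
    rw [Finset.sum_eq_single x] <;> simp +contextual [eq_comm]
  · simp only [h, if_false]
    refine Finset.sum_eq_zero fun z _ => Finset.sum_eq_zero fun c _ => ?_
    by_cases h1 : x = z
    · subst h1; simp [h]
    · simp [h1]

lemma bdiag_conjTranspose (F : o → Matrix r r ℂ) :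
    (bdiag F)ᴴ = bdiag (fun x => (F x)ᴴ) := by
  ext ⟨x, a⟩ ⟨y, b⟩
  simp only [bdiag, of_apply, conjTranspose_apply]
  by_cases h : x = y
  · subst h; simp
  · simp [h, Ne.symm h]

lemma bdiag_trace [Fintype o] [Fintype r] (F : o → Matrix r r ℂ) :
    (bdiag F).trace = ∑ x, (F x).trace := by
  simp [bdiag, Matrix.trace, Fintype.sum_prod_type]

lemma bdiag_frob [Fintype o] [Fintype r] (F : o → Matrix r r ℂ) :
    frob (bdiag F) = ∑ x, frob (F x) := by
  rw [frob_eq, bdiag_conjTranspose, bdiag_mul, bdiag_trace, Complex.re_sum]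
  simp only [frob_eq]

lemma bdiag_posSemidef [Fintype o] [Fintype r] (F : o → Matrix r r ℂ)
    (h : ∀ x, ∃ C : Matrix r r ℂ, F x = Cᴴ * C) :
    (bdiag F).PosSemidef := by
  choose C hC using h
  have : bdiag F = (bdiag C)ᴴ * bdiag C := by
    rw [bdiag_conjTranspose, bdiag_mul]; congr 1; ext1 x; exact hC x
  rw [this]
  exact posSemidef_conjTranspose_mul_self _
end bd

lemma posSemidef_exists {r : Type} [Fintype r] [DecidableEq r] {A : Matrix r r ℂ}
    (h : A.PosSemidef) : ∃ C : Matrix r r ℂ, A = Cᴴ * C := by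
  refine ⟨specFun h.1 Real.sqrt, ?_⟩
  rw [specFun_herm, specFun_mul]
  conv_lhs => rw [← specFun_id h.1]
  exact specFun_congr _ _ _ fun i => (Real.mul_self_sqrt (h.eigenvalues_nonneg i)).symm

lemma root_pack {r : Type} [Fintype r] [DecidableEq r] {ρ : Matrix r r ℂ} (h : ρ.PosSemidef) :
    ∃ G Gi : Matrix r r ℂ, Gᴴ = G ∧ Giᴴ = Gi ∧ G * G * (G * G) = ρ ∧ G * Gi = Gi * G ∧
      ρ * (1 - Gi * G) = 0 ∧ Gi * Gi * ρ * (Gi * Gi) = Gi * G ∧ (Gi * G) * (Gi * G) = Gi * G := by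
  have hs : ∀ i, 0 ≤ h.1.eigenvalues i := h.eigenvalues_nonneg
  have key : ∀ t : ℝ, 0 ≤ t → ∃ s : ℝ, Real.sqrt (Real.sqrt t) = s ∧ t = s * s * (s * s) := by
    intro t ht
    refine ⟨_, rfl, ?_⟩
    rw [Real.mul_self_sqrt (Real.sqrt_nonneg _), Real.mul_self_sqrt ht]
  have hid := specFun_id h.1
  refine ⟨specFun h.1 (fun t => Real.sqrt (Real.sqrt t)),
    specFun h.1 (fun t => (Real.sqrt (Real.sqrt t))⁻¹), specFun_herm _ _, specFun_herm _ _,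
    ?_, ?_, ?_, ?_, ?_⟩
  · conv_rhs => rw [← hid]
    simp only [specFun_mul]
    apply specFun_congr
    intro i
    obtain ⟨s, h1, h2⟩ := key _ (hs i)
    rw [h1, ← h2]
  · simp only [specFun_mul]
    apply specFun_congr
    intro i
    ring
  · rw [mul_sub, mul_one, sub_eq_zero]
    have : specFun h.1 (fun t => t) = specFun h.1 (fun t => t) * (specFun h.1 (fun t => (Real.sqrt (Real.sqrt t))⁻¹) *
        specFun h.1 (fun t => Real.sqrt (Real.sqrt t))) := by
      simp only [specFun_mul]
      apply specFun_congr
      intro i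
      obtain ⟨s, h1, h2⟩ := key _ (hs i)
      rw [h1]
      by_cases h0 : s = 0
      · simp [h0]
        rw [h2, h0]; simp
      · field_simp
    rwa [hid] at this
  · have : ∀ X : Matrix r r ℂ, X * ρ = X * specFun h.1 (fun t => t) := fun X => by rw [hid]
    rw [this]
    simp only [specFun_mul]
    apply specFun_congr
    intro i
    obtain ⟨s, h1, h2⟩ := key _ (hs i)
    rw [h1]
    by_cases h0 : s = 0
    · simp [h0]
    · rw [h2]; field_simp
  · simp only [specFun_mul]
    apply specFun_congr
    intro i
    obtain ⟨s, h1, h2⟩ := key _ (hs i)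
    rw [h1]
    by_cases h0 : s = 0
    · simp [h0]
    · field_simp

/-- Support lemma: the projection off the support of the sum kills each summand. -/
lemma support_kill {N r : Type} [Fintype N] [Fintype r] [DecidableEq r] (A : N → Matrix r r ℂ)
    (hA : ∀ x, (A x).PosSemidef) (Q : Matrix r r ℂ) (hQ : (∑ x, A x) * Q = 0) (x : N) :
    A x * Q = 0 := by
  have hps : ∀ x, (Qᴴ * A x * Q).PosSemidef := fun x => (hA x).conjTranspose_mul_mul_same Q
  have hsum : ∑ x, (Qᴴ * A x * Q).trace = 0 := by
    rw [← Matrix.trace_sum]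
    simp only [Matrix.mul_assoc]
    rw [← Finset.mul_sum, ← Finset.sum_mul, hQ]
    simp
  have h0 : (Qᴴ * A x * Q).trace = 0 :=
    (Finset.sum_eq_zero_iff_of_nonneg (fun y _ => (hps y).trace_nonneg)).mp hsum x (Finset.mem_univ _)
  have h1 := (hps x).trace_eq_zero_iff.mp h0
  obtain ⟨C, hC⟩ := posSemidef_exists (hA x)
  have h2 : (C * Q)ᴴ * (C * Q) = 0 := by
    rw [conjTranspose_mul, ← h1, hC]; simp only [Matrix.mul_assoc]
  have h3 := conjTranspose_mul_self_eq_zero.mp h2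
  rw [hC, Matrix.mul_assoc, h3, Matrix.mul_zero]

/-- The centred coefficients of the extractor map `ψ - τ`. -/
noncomputable def coef {N M D : Type} [Fintype M] [DecidableEq M] [Fintype D]
    (f : D → N → M) (mi : M × D) (x : N) : ℝ :=
  (if f mi.2 x = mi.1 then 1 else 0) / (Fintype.card D : ℝ) -
    1 / ((Fintype.card M : ℝ) * Fintype.card D)

lemma coef_real {N M D : Type} [Fintype N] [Fintype M] [DecidableEq M] [Fintype D]
    [Nonempty M] [Nonempty D] (f : D → N → M) (P : N → ℝ) :
    ∑ mi : M × D, (∑ x, coef f mi x * P x) ^ 2 =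
      (∑ mi : M × D, ((∑ x, if f mi.2 x = mi.1 then P x else 0) / (Fintype.card D : ℝ)) ^ 2)
      - (∑ _mi : M × D, ((∑ x, P x) / (Fintype.card M * Fintype.card D : ℝ)) ^ 2) := by
  have hM : (Fintype.card M : ℝ) ≠ 0 := by simp
  have hD : (Fintype.card D : ℝ) ≠ 0 := by simp
  set T := ∑ x, P x with hT
  have e1 : ∀ mi : M × D, ∑ x, coef f mi x * P x =
      (∑ x, if f mi.2 x = mi.1 then P x else 0) / (Fintype.card D : ℝ) -
        T / (Fintype.card M * Fintype.card D : ℝ) := by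
    intro mi
    rw [hT, Finset.sum_div, Finset.sum_div, ← Finset.sum_sub_distrib]
    refine Finset.sum_congr rfl fun x _ => ?_
    unfold coef
    split_ifs <;> ring
  have e2 : ∑ mi : M × D, (∑ x, if f mi.2 x = mi.1 then P x else 0) / (Fintype.card D : ℝ) = T := by
    rw [← Finset.sum_div, Fintype.sum_prod_type_right]
    have : ∀ d : D, ∑ m : M, (∑ x, if f d x = m then P x else 0) = T := by
      intro d
      rw [Finset.sum_comm]
      simp [hT]
    simp only [this]
    simp
  simp only [e1]
  set w : M × D → ℝ := fun mi => (∑ x, if f mi.2 x = mi.1 then P x else 0) / (Fintype.card D : ℝ)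
  set c := T / (Fintype.card M * Fintype.card D : ℝ) with hc
  have e3 : ∀ mi, (w mi - c) ^ 2 = w mi ^ 2 - 2 * c * w mi + c ^ 2 := fun mi => by ring
  change ∑ mi, (w mi - c) ^ 2 = ∑ mi, w mi ^ 2 - _
  simp only [e3, Finset.sum_add_distrib, Finset.sum_sub_distrib, ← Finset.mul_sum]
  rw [show ∑ mi, w mi = T from e2]
  simp only [Finset.sum_const, Finset.card_univ, Fintype.card_prod, nsmul_eq_mul, Nat.cast_mul]
  rw [hc]
  field_simp
  ring

lemma coef_frob {N M D R : Type} [Fintype N] [Fintype M] [DecidableEq M] [Fintype D] [Fintype R]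
    (f : D → N → M) (K : ℝ)
    (h : ∀ P : N → ℝ, ∑ mi : M × D, (∑ x, coef f mi x * P x) ^ 2 ≤ K * ∑ x, P x ^ 2)
    (X : N → Matrix R R ℂ) :
    ∑ mi : M × D, frob (∑ x, (coef f mi x : ℂ) • X x) ≤ K * ∑ x, frob (X x) := by
  have hn : ∀ z : ℂ, ‖z‖ ^ 2 = z.re ^ 2 + z.im ^ 2 := fun z => by
    rw [← Complex.normSq_eq_norm_sq, Complex.normSq_apply]; ring
  unfold frob
  rw [Finset.sum_comm, Finset.sum_comm (s := (Finset.univ : Finset N)), Finset.mul_sum]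
  refine Finset.sum_le_sum fun i _ => ?_
  rw [Finset.sum_comm, Finset.sum_comm (s := (Finset.univ : Finset N)), Finset.mul_sum]
  refine Finset.sum_le_sum fun j _ => ?_
  have h1 := h (fun x => (X x i j).re)
  have h2 := h (fun x => (X x i j).im)
  simp only [hn, Matrix.sum_apply, Matrix.smul_apply, smul_eq_mul, Complex.re_sum, Complex.im_sum,
    Complex.re_ofReal_mul, Complex.im_ofReal_mul, Finset.sum_add_distrib]
  linarith

/-- every (k,ε) spectral extractor is a quantum-proof (k, 2√ε) extractor.
The spectral hypothesis `λ_max(ψ†∘ψ − τ†∘τ) ≤ 2^k ε/(|M||D|)` is expressed through the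
Rayleigh quotient of the symmetric operator `ψ†∘ψ − τ†∘τ`: for all `P`,
`‖ψ(P)‖² − ‖τ(P)‖² ≤ 2^k ε/(|M||D|) ‖P‖²`; the min-entropy hypothesis
`H_min(N|R)_ρ ≥ k` is expressed as `p_guess(N|R)_ρ ≤ 2^{−k}`. -/
theorem spectral_extractor_quantum_proof
    {N M D R : Type} [Fintype N] [DecidableEq N] [Fintype M] [DecidableEq M]
    [Fintype D] [DecidableEq D] [Fintype R] [DecidableEq R]
    [Nonempty N] [Nonempty M] [Nonempty D]
    (f : D → N → M) (k ε : ℝ) (hε : 0 < ε)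
    -- spectral extractor condition on ψ(P) = (1/|D|) Σ_i P_{f_i(N)} ⊗ |i⟩⟨i| and
    -- τ(P) = (Σ_j P_j) · u_M ⊗ u_D
    (hspec : ∀ P : N → ℝ,
      (∑ mi : M × D, ((∑ x, if f mi.2 x = mi.1 then P x else 0) / (Fintype.card D)) ^ 2)
      - (∑ _mi : M × D, ((∑ x, P x) / (Fintype.card M * Fintype.card D)) ^ 2)
      ≤ 2 ^ k * ε / (Fintype.card M * Fintype.card D) * ∑ x, (P x) ^ 2)
    -- the classical-quantum input state ρ_{NR} = Σ_x p(x)|x⟩⟨x| ⊗ ρ_R^x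
    (p : N → ℝ) (hp : ∀ x, 0 ≤ p x) (hp1 : ∑ x, p x = 1)
    (ρx : N → Matrix R R ℂ) (hρx : ∀ x, (ρx x).PosSemidef) (hρxtr : ∀ x, (ρx x).trace = 1)
    (ρNR : Matrix (N × R) (N × R) ℂ)
    (hρNR : ρNR = Matrix.of fun xa yb =>
      if xa.1 = yb.1 then (p xa.1 : ℂ) * ρx xa.1 xa.2 yb.2 else 0)
    -- H_min(N|R)_ρ ≥ k, i.e. p_guess(N|R)_ρ ≤ 2^{-k}
    (hmin : ∀ E : Matrix (N × R) (N × R) ℂ, E.PosSemidef →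
      ptraceFst E = (1 : Matrix R R ℂ) → ((ρNR * E).trace).re ≤ 2 ^ (-k)) :
    -- ‖ (1/|D|) Σ_i ρ_{f_i(N)R} ⊗ |i⟩⟨i|  −  u_M ⊗ ρ_R ⊗ u_D ‖₁ ≤ 2√ε
    traceNorm
      ((Matrix.of fun (mia : (M × D) × R) (mjb : (M × D) × R) =>
          if mia.1 = mjb.1 then
            ((Fintype.card D : ℂ))⁻¹ *
              ∑ x, (if f mia.1.2 x = mia.1.1 then (p x : ℂ) * ρx x mia.2 mjb.2 else 0)
          else 0)
        - (Matrix.of fun (mia : (M × D) × R) (mjb : (M × D) × R) =>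
          if mia.1 = mjb.1 then
            ((Fintype.card M * Fintype.card D : ℂ))⁻¹ * ∑ x, (p x : ℂ) * ρx x mia.2 mjb.2
          else 0))
      ≤ 2 * Real.sqrt ε := by
  set A : N → Matrix R R ℂ := fun x => (p x : ℂ) • ρx x with hAdef
  have hA : ∀ x, (A x).PosSemidef := fun x =>
    (hρx x).smul (by exact_mod_cast hp x)
  set ρ := ∑ x, A x with hρdef
  have hρ : ρ.PosSemidef := Matrix.posSemidef_sum _ fun x _ => hA x
  have hρtr : ρ.trace = 1 := by
    rw [hρdef, Matrix.trace_sum]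
    simp only [hAdef, Matrix.trace_smul, hρxtr, smul_eq_mul, mul_one]
    exact_mod_cast hp1
  obtain ⟨G, Gi, hG, hGi, hG4, hcomm, hker, hpgm, hproj⟩ := root_pack hρ
  have hAQ : ∀ x, A x * (1 - Gi * G) = 0 := support_kill A hA _ hker
  have hQA : ∀ x, (1 - Gi * G) * A x = 0 := fun x => by
    have := congrArg conjTranspose (hAQ x)
    rw [conjTranspose_mul, (hA x).1.eq] at this
    simpa [conjTranspose_sub, conjTranspose_mul, hG, hGi, hcomm] using this
  have hAP : ∀ x, A x * (Gi * G) = A x := fun x => by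
    have := hAQ x
    rw [mul_sub, mul_one, sub_eq_zero] at this
    exact this.symm
  have hPA : ∀ x, (Gi * G) * A x = A x := fun x => by
    have := hQA x
    rw [sub_mul, one_mul, sub_eq_zero] at this
    exact this.symm
  set X : N → Matrix R R ℂ := fun x => Gi * A x * Gi with hX
  have hXA : ∀ x, G * X x * G = A x := fun x => by
    calc G * X x * G = (G * Gi) * A x * (Gi * G) := by simp only [hX, Matrix.mul_assoc]
      _ = A x := by rw [hcomm, hPA, hAP]
  have hXh : ∀ x, (X x)ᴴ = X x := fun x => by
    simp only [hX, conjTranspose_mul, hGi, (hA x).1.eq, Matrix.mul_assoc]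
  -- pretty good measurement
  have hcard : (0 : ℝ) < Fintype.card N := by exact_mod_cast Fintype.card_pos
  set Q : Matrix R R ℂ := 1 - Gi * G with hQ
  have hQh : Qᴴ = Q := by simp [hQ, conjTranspose_sub, conjTranspose_mul, hG, hGi, hcomm]
  have hQQ : Q * Q = Q := by
    rw [hQ, sub_mul, one_mul, mul_sub, mul_one, hproj, sub_self, sub_zero]
  set E : N → Matrix R R ℂ := fun x => Gi * Gi * A x * (Gi * Gi) + ((Fintype.card N : ℝ)⁻¹ : ℂ) • Q with hE
  have hEps : ∀ x, (E x).PosSemidef := fun x => by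
    refine Matrix.PosSemidef.add ?_ ?_
    · have := (hA x).conjTranspose_mul_mul_same (Gi * Gi)
      rwa [conjTranspose_mul, hGi] at this
    · refine Matrix.PosSemidef.smul ?_ ?_
      · have := posSemidef_conjTranspose_mul_self Q
        rwa [hQh, hQQ] at this
      · have h0 : (0 : ℝ) ≤ (Fintype.card N : ℝ)⁻¹ := by positivity
        exact_mod_cast h0
  have hEsum : ptraceFst (bdiag E) = (1 : Matrix R R ℂ) := by
    have h1 : ptraceFst (bdiag E) = ∑ x, E x := by
      ext a b
      simp [ptraceFst, bdiag, Matrix.sum_apply]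
    have hc : (Fintype.card N : ℂ) ≠ 0 := by simp
    rw [h1]
    simp only [hE, Finset.sum_add_distrib]
    rw [← Finset.sum_mul, ← Finset.mul_sum, ← hρdef, hpgm]
    simp only [Finset.sum_const, Finset.card_univ]
    rw [← Nat.cast_smul_eq_nsmul ℂ, smul_smul]
    push_cast
    rw [mul_inv_cancel₀ hc, one_smul, hQ]
    abel
  have hρb : ρNR = bdiag A := by
    rw [hρNR]; rfl
  have hguess := hmin (bdiag E) (bdiag_posSemidef _ fun x => posSemidef_exists (hEps x)) hEsum
  have hXX : ∑ x, frob (X x) ≤ 2 ^ (-k) := by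
    refine le_trans (le_of_eq ?_) hguess
    rw [hρb, bdiag_mul, bdiag_trace, Complex.re_sum]
    refine Finset.sum_congr rfl fun x _ => ?_
    rw [frob_eq, hXh]
    congr 1
    simp only [hE, mul_add, Matrix.mul_smul, hAQ x, smul_zero, add_zero]
    rw [show X x * X x = Gi * (A x * (Gi * Gi) * A x * Gi) by simp only [hX, Matrix.mul_assoc],
      Matrix.trace_mul_comm]
    simp only [Matrix.mul_assoc]
  -- spectral bound
  have hMD : (0 : ℝ) < (Fintype.card M : ℝ) * Fintype.card D := by
    have h1 : (0 : ℝ) < Fintype.card M := by exact_mod_cast Fintype.card_pos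
    have h2 : (0 : ℝ) < Fintype.card D := by exact_mod_cast Fintype.card_pos
    positivity
  set Y : M × D → Matrix R R ℂ := fun mi => ∑ x, (coef f mi x : ℂ) • X x with hY
  have hYf : ∑ mi, frob (Y mi) ≤ ε / ((Fintype.card M : ℝ) * Fintype.card D) := by
    have h1 := coef_frob f _ (fun P => (coef_real f P).le.trans (hspec P)) X
    refine h1.trans ?_
    have h2 : (2 : ℝ) ^ k * 2 ^ (-k) = 1 := by
      rw [← Real.rpow_add (by norm_num)]; simp
    calc _ ≤ 2 ^ k * ε / (Fintype.card M * Fintype.card D : ℝ) * 2 ^ (-k) :=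
          mul_le_mul_of_nonneg_left hXX (by positivity)
      _ = (2 ^ k * 2 ^ (-k)) * (ε / ((Fintype.card M : ℝ) * Fintype.card D)) := by ring
      _ = _ := by rw [h2, one_mul]
  have hΔ : ((Matrix.of fun (mia : (M × D) × R) (mjb : (M × D) × R) =>
          if mia.1 = mjb.1 then
            ((Fintype.card D : ℂ))⁻¹ *
              ∑ x, (if f mia.1.2 x = mia.1.1 then (p x : ℂ) * ρx x mia.2 mjb.2 else 0)
          else 0)
        - (Matrix.of fun (mia : (M × D) × R) (mjb : (M × D) × R) =>
          if mia.1 = mjb.1 then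
            ((Fintype.card M * Fintype.card D : ℂ))⁻¹ * ∑ x, (p x : ℂ) * ρx x mia.2 mjb.2
          else 0)) = bdiag (fun _ => G) * bdiag Y * bdiag (fun _ : M × D => G) := by
    have h1 : ∀ mi, G * Y mi * G = ∑ x, (coef f mi x : ℂ) • A x := fun mi => by
      simp only [hY, Finset.mul_sum, Finset.sum_mul, Matrix.mul_smul, Matrix.smul_mul, hXA]
    rw [bdiag_mul, bdiag_mul]
    simp only [h1]
    ext ⟨mi, a⟩ ⟨mj, b⟩
    simp only [bdiag, Matrix.sub_apply, of_apply]
    split_ifs with h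
    · rw [Finset.mul_sum, Finset.mul_sum, ← Finset.sum_sub_distrib, Matrix.sum_apply]
      refine Finset.sum_congr rfl fun x _ => ?_
      simp only [hAdef, Matrix.smul_apply, smul_eq_mul, coef]
      split_ifs <;> push_cast <;> ring
    · simp
  rw [hΔ]
  have hYh : ∀ mi, (Y mi)ᴴ = Y mi := fun mi => by
    simp [hY, conjTranspose_sum, conjTranspose_smul, hXh]
  have hGb : (bdiag (fun _ : M × D => G))ᴴ = bdiag (fun _ : M × D => G) := by
    rw [bdiag_conjTranspose]; simp only [hG]
  have hYb : (bdiag Y)ᴴ = bdiag Y := by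
    rw [bdiag_conjTranspose]; simp only [hYh]
  have hherm : (bdiag (fun _ => G) * bdiag Y * bdiag (fun _ : M × D => G)).IsHermitian := by
    unfold Matrix.IsHermitian
    rw [conjTranspose_mul, conjTranspose_mul, hGb, hYb, Matrix.mul_assoc]
  obtain ⟨S, hS, hSS, hnorm⟩ := traceNorm_eq hherm
  rw [hnorm]
  have hGtr : ((bdiag (fun _ : M × D => G) * bdiag (fun _ : M × D => G) *
      (bdiag (fun _ : M × D => G) * bdiag (fun _ : M × D => G))).trace).re =
      (Fintype.card M : ℝ) * Fintype.card D := by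
    simp only [bdiag_mul]
    rw [bdiag_trace]
    simp only [hG4, hρtr]
    simp
  have hb := frob_conj_bound S (bdiag (fun _ : M × D => G)) hS hSS hGb
  rw [hGtr] at hb
  rw [show S * (bdiag (fun _ => G) * bdiag Y * bdiag (fun _ : M × D => G)) =
    (S * bdiag (fun _ => G) * bdiag Y) * bdiag (fun _ : M × D => G) by simp only [Matrix.mul_assoc],
    Matrix.trace_mul_comm,
    show bdiag (fun _ : M × D => G) * (S * bdiag (fun _ => G) * bdiag Y) =
      (bdiag (fun _ : M × D => G) * S * bdiag (fun _ => G)) * bdiag Y by simp only [Matrix.mul_assoc]]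
  refine (frob_cs _ _).trans ?_
  calc _ ≤ Real.sqrt ((Fintype.card M : ℝ) * Fintype.card D) *
        Real.sqrt (ε / ((Fintype.card M : ℝ) * Fintype.card D)) := by
        refine mul_le_mul (Real.sqrt_le_sqrt hb) (Real.sqrt_le_sqrt ?_) (Real.sqrt_nonneg _)
          (Real.sqrt_nonneg _)
        rw [bdiag_frob]; exact hYf
    _ = Real.sqrt ε := by
        rw [← Real.sqrt_mul hMD.le, mul_div_cancel₀ _ hMD.ne']
    _ ≤ 2 * Real.sqrt ε := by linarith [Real.sqrt_nonneg ε]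
end

section
/- Every (k,ε)-quantum spectral extractor is a decoupling (k, 2√ε)-quantum extractor: if unitaries {U^1,…,U^D} on H_N satisfy λ_max(ψ†∘ψ − τ†∘τ) ≤ 2^k ε/(|M|·|D|) for ψ(ρ) = (1/D) Σ_i tr_{N\M}[U^i ρ (U^i)†] ⊗ |i⟩⟨i| and τ(ρ) = tr[ρ]·(1_M/|M|) ⊗ (1_D/|D|), then for every bipartite density operator ρ_{NR} with H_min(N|R)_ρ ≥ k, ‖(1/D) Σ_i tr_{N\M}[U^i ρ_{NR} (U^i)†] ⊗ |i⟩⟨i| − (1_M/|M|) ⊗ ρ_R ⊗ (1_D/|D|)‖_1 ≤ 2√ε. -/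
open Matrix Finset
open scoped ComplexOrder Kronecker

/-- Squared Hilbert–Schmidt norm. -/
noncomputable def hsNormSq {n : Type} [Fintype n] (A : Matrix n n ℂ) : ℝ :=
  ((Aᴴ * A).trace).re

/-- Partial trace over the whole `N = M ⊗ (N\M)` system of an operator on `N ⊗ R`. -/
noncomputable def ptraceN {m j r : Type} [Fintype m] [Fintype j] [Fintype r]
    (A : Matrix ((m × j) × r) ((m × j) × r) ℂ) : Matrix r r ℂ :=
  Matrix.of fun a b => ∑ x : m × j, A (x, a) (x, b)

lemma aux_le_sq {a b : ℝ} (h : a ^ 2 ≤ b ^ 2) (hb : 0 ≤ b) : a ≤ b := by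
  nlinarith [abs_le_of_sq_le_sq h hb, le_abs_self a]

lemma aux_hs_eq {n : Type} [Fintype n] (A : Matrix n n ℂ) :
    hsNormSq A = ∑ i, ∑ j, ‖A i j‖ ^ 2 := by
  unfold hsNormSq
  simp only [Matrix.trace, Matrix.diag, Matrix.mul_apply, Matrix.conjTranspose_apply]
  rw [Finset.sum_comm, Complex.re_sum]
  refine Finset.sum_congr rfl fun i _ => ?_
  rw [Complex.re_sum]
  refine Finset.sum_congr rfl fun j _ => ?_
  rw [Complex.star_def, ← Complex.normSq_eq_conj_mul_self, Complex.ofReal_re, Complex.normSq_eq_norm_sq]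

lemma aux_hs_nonneg {n : Type} [Fintype n] (A : Matrix n n ℂ) : 0 ≤ hsNormSq A := by
  rw [aux_hs_eq]; positivity

lemma aux_cs {n : Type} [Fintype n] (A B : Matrix n n ℂ) :
    ((A * B).trace).re ^ 2 ≤ hsNormSq A * hsNormSq B := by
  have h1 : |((A * B).trace).re| ≤ ∑ p : n × n, ‖A p.1 p.2‖ * ‖B p.2 p.1‖ := by
    refine (Complex.abs_re_le_norm _).trans ?_
    simp only [Matrix.trace, Matrix.diag, Matrix.mul_apply]
    rw [Fintype.sum_prod_type]
    refine (norm_sum_le _ _).trans (Finset.sum_le_sum fun i _ => ?_)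
    refine (norm_sum_le _ _).trans (Finset.sum_le_sum fun j _ => ?_)
    rw [norm_mul]
  have h2 := Finset.sum_mul_sq_le_sq_mul_sq (Finset.univ : Finset (n × n))
    (fun p => ‖A p.1 p.2‖) (fun p => ‖B p.2 p.1‖)
  have h3 : hsNormSq A = ∑ p : n × n, ‖A p.1 p.2‖ ^ 2 := by
    rw [aux_hs_eq, Fintype.sum_prod_type]
  have h4 : hsNormSq B = ∑ p : n × n, ‖B p.2 p.1‖ ^ 2 := by
    rw [aux_hs_eq, Fintype.sum_prod_type, Finset.sum_comm]
  rw [h3, h4]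
  refine le_trans ?_ h2
  rw [← sq_abs]
  gcongr

lemma aux_polar {n : Type} [Fintype n] [DecidableEq n] (A : Matrix n n ℂ) :
    ∃ C : Matrix n n ℂ, (1 - C * Cᴴ).PosSemidef ∧ (1 - Cᴴ * C).PosSemidef ∧
      ((C * A).trace).re = traceNorm A := by
  set hH := (Matrix.posSemidef_conjTranspose_mul_self A).1 with hHdef
  set d := hH.eigenvalues with hd
  have hd0 : ∀ i, 0 ≤ d i := (Matrix.posSemidef_conjTranspose_mul_self A).eigenvalues_nonneg
  set W : Matrix n n ℂ := (hH.eigenvectorUnitary : Matrix n n ℂ) with hW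
  have hWW : Wᴴ * W = 1 := Matrix.mem_unitaryGroup_iff'.1 hH.eigenvectorUnitary.2
  have hWW' : W * Wᴴ = 1 := Matrix.mem_unitaryGroup_iff.1 hH.eigenvectorUnitary.2
  have hdiag : Wᴴ * (Aᴴ * A) * W = diagonal (fun i => (d i : ℂ)) := by
    have h := hH.spectral_theorem
    rw [Unitary.conjStarAlgAut_apply] at h
    have h' : Aᴴ * A = W * diagonal (fun i => (d i : ℂ)) * Wᴴ := h
    rw [h']
    calc _ = (Wᴴ * W) * diagonal (fun i => (d i : ℂ)) * (Wᴴ * W) := by simp only [Matrix.mul_assoc]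
      _ = _ := by rw [hWW]; simp
  set e : n → ℂ := fun i => (((Real.sqrt (d i))⁻¹ : ℝ) : ℂ) with he
  set P : Matrix n n ℂ := diagonal (fun i => if d i = 0 then 0 else 1) with hP
  have hPH : Pᴴ = P := by
    rw [hP, diagonal_conjTranspose]; congr 1; ext i; simp only [Pi.star_apply]; split_ifs <;> simp
  have hPP : P * P = P := by
    rw [hP, diagonal_mul_diagonal]; congr 1; ext i; split_ifs <;> simp
  have heH : (diagonal e)ᴴ = diagonal e := by
    rw [diagonal_conjTranspose]; congr 1; ext i; simp [he]
  have heP : diagonal e * P = diagonal e := by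
    rw [hP, diagonal_mul_diagonal]; congr 1; ext i; simp only [he]; split_ifs with h <;> simp [h]
  set Q := A * W * diagonal e with hQ
  have hQH : Qᴴ = diagonal e * Wᴴ * Aᴴ := by
    rw [hQ, conjTranspose_mul, conjTranspose_mul, heH, Matrix.mul_assoc]
  have hsq : ∀ i, (Real.sqrt (d i)) * (Real.sqrt (d i)) = d i := fun i => Real.mul_self_sqrt (hd0 i)
  have hQQ : Qᴴ * Q = P := by
    calc Qᴴ * Q = diagonal e * (Wᴴ * (Aᴴ * A) * W) * diagonal e := by
          rw [hQH, hQ]; simp only [Matrix.mul_assoc]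
      _ = P := by
          rw [hdiag, diagonal_mul_diagonal, diagonal_mul_diagonal, hP]
          congr 1; ext i
          simp only [he]
          split_ifs with h
          · simp [h]
          · have : Real.sqrt (d i) ≠ 0 := by
              intro h0; apply h; rw [← hsq i, h0, zero_mul]
            rw [← Complex.ofReal_mul, ← Complex.ofReal_mul]
            nth_rewrite 2 [← hsq i]
            field_simp
            simp
  have hQP : Q * P = Q := by rw [hQ, Matrix.mul_assoc, heP]
  clear_value Q
  have proj : ∀ X : Matrix n n ℂ, Xᴴ = X → X * X = X → (1 - X).PosSemidef := by
    intro X h1 h2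
    have : 1 - X = (1 - X)ᴴ * (1 - X) := by
      rw [conjTranspose_sub, h1, conjTranspose_one, Matrix.sub_mul, Matrix.mul_sub, Matrix.mul_sub, h2]
      simp
    rw [this]
    exact Matrix.posSemidef_conjTranspose_mul_self _
  refine ⟨W * Qᴴ, proj _ ?_ ?_, proj _ ?_ ?_, ?_⟩
  · simp [conjTranspose_mul, Matrix.mul_assoc]
  · have h : W * Qᴴ * (W * Qᴴ)ᴴ = W * P * Wᴴ := by
      rw [conjTranspose_mul, conjTranspose_conjTranspose, ← hQQ]; simp only [Matrix.mul_assoc]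
    rw [h]
    calc _ = W * P * (Wᴴ * W) * P * Wᴴ := by simp only [Matrix.mul_assoc]
      _ = W * (P * P) * Wᴴ := by rw [hWW]; simp only [Matrix.mul_assoc, Matrix.one_mul]
      _ = _ := by rw [hPP]
  · simp [conjTranspose_mul, Matrix.mul_assoc]
  · have h : (W * Qᴴ)ᴴ * (W * Qᴴ) = Q * Qᴴ := by
      rw [conjTranspose_mul, conjTranspose_conjTranspose]
      calc _ = Q * (Wᴴ * W) * Qᴴ := by simp only [Matrix.mul_assoc]
        _ = _ := by rw [hWW, Matrix.mul_one]
    rw [h]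
    calc _ = Q * (Qᴴ * Q) * Qᴴ := by simp only [Matrix.mul_assoc]
      _ = _ := by rw [hQQ, hQP]
  · have h : (W * Qᴴ * A).trace = (diagonal e * (Wᴴ * (Aᴴ * A) * W)).trace := by
      rw [Matrix.mul_assoc, Matrix.trace_mul_comm, hQH]; simp only [Matrix.mul_assoc]
    rw [h, hdiag, diagonal_mul_diagonal, Matrix.trace_diagonal, Complex.re_sum]
    unfold traceNorm
    refine Finset.sum_congr rfl fun i _ => ?_
    simp only [he]
    rw [← Complex.ofReal_mul, Complex.ofReal_re]
    change _ = Real.sqrt (d i)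
    nth_rewrite 2 [← hsq i]
    by_cases h0 : Real.sqrt (d i) = 0
    · simp [h0]
    · field_simp

lemma aux_psd_trace {n : Type} [Fintype n] [DecidableEq n] (X Y : Matrix n n ℂ) (hY : Y.PosSemidef) :
    0 ≤ ((X * Y * Xᴴ).trace).re := by
  have := (hY.mul_mul_conjTranspose_same X).trace_nonneg
  exact (Complex.le_def.1 this).1

lemma aux_traceNorm {n : Type} [Fintype n] [DecidableEq n] (S B : Matrix n n ℂ) (hS : Sᴴ = S) :
    traceNorm (S * B * S) ^ 2 ≤ ((S * S * (S * S)).trace).re * hsNormSq B := by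
  obtain ⟨C, h1, h2, h3⟩ := aux_polar (S * B * S)
  rw [← h3]
  set G := S * S with hG
  have hGH : Gᴴ = G := by rw [hG, conjTranspose_mul, hS]
  set t := ((G * G).trace).re with ht
  have e1 : (C * (S * B * S)).trace = ((S * C * S) * B).trace := by
    rw [Matrix.trace_mul_comm (S * C * S)]
    rw [show C * (S * B * S) = (C * (S * B)) * S by simp only [Matrix.mul_assoc]]
    rw [Matrix.trace_mul_comm, Matrix.trace_mul_comm B]
    simp only [Matrix.mul_assoc]
  rw [e1]
  refine (aux_cs _ _).trans (mul_le_mul_of_nonneg_right ?_ (aux_hs_nonneg B))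
  have e2 : hsNormSq (S * C * S) = (((G * Cᴴ) * (G * C)).trace).re := by
    unfold hsNormSq
    congr 1
    rw [conjTranspose_mul, conjTranspose_mul, hS]
    rw [show S * (Cᴴ * S) * (S * C * S) = (S * Cᴴ * G * C) * S by
      rw [hG]; simp only [Matrix.mul_assoc]]
    rw [Matrix.trace_mul_comm, hG]
    simp only [Matrix.mul_assoc]
  have b : ∀ K : Matrix n n ℂ, (1 - K * Kᴴ).PosSemidef → hsNormSq (G * K) ≤ t := by
    intro K hK
    have := aux_psd_trace G _ hK
    rw [Matrix.mul_sub, Matrix.sub_mul, Matrix.trace_sub, Complex.sub_re, hGH, Matrix.mul_one] at this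
    unfold hsNormSq
    rw [Matrix.trace_mul_comm, conjTranspose_mul, hGH]
    simp only [Matrix.mul_assoc] at this ⊢
    linarith
  have c1 := b C h1
  have c2 := b Cᴴ (by rwa [conjTranspose_conjTranspose])
  have c3 := aux_cs (G * Cᴴ) (G * C)
  rw [← e2] at c3
  have n1 := aux_hs_nonneg (G * C)
  have n2 := aux_hs_nonneg (G * Cᴴ)
  have c4 : hsNormSq (S * C * S) ^ 2 ≤ t ^ 2 := by
    rw [sq t]; exact c3.trans (mul_le_mul c2 c1 n1 (n2.trans c2))
  exact aux_le_sq c4 (n1.trans c1)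

lemma aux_hs_sub {n : Type} [Fintype n] [DecidableEq n] (P : Matrix n n ℂ) (c : ℂ)
    (h : P.trace = Fintype.card n * c) :
    hsNormSq (P - c • (1 : Matrix n n ℂ)) = hsNormSq P - hsNormSq (c • (1 : Matrix n n ℂ)) := by
  unfold hsNormSq
  simp only [conjTranspose_sub, conjTranspose_smul, conjTranspose_one, Matrix.sub_mul, Matrix.mul_sub,
    Matrix.trace_sub, Matrix.smul_mul, Matrix.mul_smul, Matrix.one_mul, Matrix.mul_one,
    Matrix.trace_smul, Matrix.trace_conjTranspose, Matrix.trace_one, h, smul_eq_mul,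
    ← Complex.sub_re]
  congr 1
  simp
  ring

/-- block of an operator on a tensor product -/
def auxBlock {n r : Type} (A : Matrix (n × r) (n × r) ℂ) (a b : r) : Matrix n n ℂ :=
  Matrix.of fun x y => A (x, a) (y, b)

/-- `Φ ⊗ id` -/
def auxExt {n p r : Type} (Φ : Matrix n n ℂ →ₗ[ℂ] Matrix p p ℂ) (A : Matrix (n × r) (n × r) ℂ) :
    Matrix (p × r) (p × r) ℂ :=
  Matrix.of fun x y => Φ (auxBlock A x.2 y.2) x.1 y.1

lemma aux_conj_apply {n r : Type} [Fintype n] [DecidableEq n] [Fintype r]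
    (S T : Matrix r r ℂ) (A : Matrix (n × r) (n × r) ℂ) (x y : n × r) :
    (((1 : Matrix n n ℂ) ⊗ₖ S) * A * ((1 : Matrix n n ℂ) ⊗ₖ T)) x y
      = ∑ c, ∑ d, (S x.2 c * T d y.2) * A (x.1, c) (y.1, d) := by
  simp only [Matrix.mul_apply, Fintype.sum_prod_type, kroneckerMap_apply, Matrix.one_apply, ite_mul,
    one_mul, zero_mul, mul_ite, mul_zero]
  simp only [Finset.sum_ite_irrel, Finset.sum_const_zero, Finset.sum_ite_eq, Finset.sum_ite_eq',
    Finset.mem_univ, if_true, Finset.sum_mul]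
  rw [Finset.sum_comm]
  exact Finset.sum_congr rfl fun c _ => Finset.sum_congr rfl fun d _ => by ring

lemma aux_ext_conj {n p r : Type} [Fintype n] [DecidableEq n] [Fintype p] [DecidableEq p] [Fintype r]
    (Φ : Matrix n n ℂ →ₗ[ℂ] Matrix p p ℂ) (S T : Matrix r r ℂ) (A : Matrix (n × r) (n × r) ℂ) :
    auxExt Φ (((1 : Matrix n n ℂ) ⊗ₖ S) * A * ((1 : Matrix n n ℂ) ⊗ₖ T))
      = ((1 : Matrix p p ℂ) ⊗ₖ S) * auxExt Φ A * ((1 : Matrix p p ℂ) ⊗ₖ T) := by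
  have hb : ∀ a b, auxBlock (((1 : Matrix n n ℂ) ⊗ₖ S) * A * ((1 : Matrix n n ℂ) ⊗ₖ T)) a b
      = ∑ c, ∑ d, (S a c * T d b) • auxBlock A c d := by
    intro a b; ext x y
    simp only [auxBlock, of_apply, aux_conj_apply, Matrix.sum_apply, Matrix.smul_apply, smul_eq_mul]
  ext x y
  rw [aux_conj_apply]
  simp only [auxExt, of_apply, hb, map_sum, map_smul, Matrix.sum_apply, Matrix.smul_apply, smul_eq_mul]

lemma aux_hs_blocks {n r : Type} [Fintype n] [Fintype r] (A : Matrix (n × r) (n × r) ℂ) :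
    hsNormSq A = ∑ a, ∑ b, hsNormSq (auxBlock A a b) := by
  simp only [aux_hs_eq, auxBlock, of_apply, Fintype.sum_prod_type]
  rw [Finset.sum_comm]
  refine Finset.sum_congr rfl fun a _ => ?_
  symm
  rw [Finset.sum_comm]
  exact Finset.sum_congr rfl fun x _ => Finset.sum_comm

lemma aux_hs_ext {n p r : Type} [Fintype n] [Fintype p] [Fintype r]
    (Φ : Matrix n n ℂ →ₗ[ℂ] Matrix p p ℂ) (l : ℝ) (h : ∀ X : Matrix n n ℂ, hsNormSq (Φ X) ≤ l * hsNormSq X)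
    (A : Matrix (n × r) (n × r) ℂ) : hsNormSq (auxExt Φ A) ≤ l * hsNormSq A := by
  rw [aux_hs_blocks, aux_hs_blocks A, Finset.mul_sum]
  refine Finset.sum_le_sum fun a _ => ?_
  rw [Finset.mul_sum]
  refine Finset.sum_le_sum fun b _ => ?_
  have e : auxBlock (auxExt Φ A) a b = Φ (auxBlock A a b) := by
    ext x y
    simp only [auxBlock, auxExt, of_apply]
  rw [e]
  exact h _

lemma aux_root {r : Type} [Fintype r] [DecidableEq r] (σ : Matrix r r ℂ) (h : σ.PosDef) :
    ∃ S T : Matrix r r ℂ, Sᴴ = S ∧ Tᴴ = T ∧ S * T = 1 ∧ T * S = 1 ∧ S * S * (S * S) = σ := by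
  set W : Matrix r r ℂ := (h.1.eigenvectorUnitary : Matrix r r ℂ) with hW
  set d := h.1.eigenvalues with hd
  have hd0 : ∀ i, 0 < d i := h.eigenvalues_pos
  have hWW : Wᴴ * W = 1 := Matrix.mem_unitaryGroup_iff'.1 h.1.eigenvectorUnitary.2
  have hWW' : W * Wᴴ = 1 := Matrix.mem_unitaryGroup_iff.1 h.1.eigenvectorUnitary.2
  have hs : σ = W * diagonal (fun i => (d i : ℂ)) * Wᴴ := by
    have h := h.1.spectral_theorem
    rw [Unitary.conjStarAlgAut_apply] at h
    exact h
  clear_value W d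
  have hm : ∀ f g : r → ℂ, (W * diagonal f * Wᴴ) * (W * diagonal g * Wᴴ)
      = W * diagonal (fun i => f i * g i) * Wᴴ := by
    intro f g
    calc _ = W * diagonal f * (Wᴴ * W) * diagonal g * Wᴴ := by simp only [Matrix.mul_assoc]
      _ = W * (diagonal f * diagonal g) * Wᴴ := by
        rw [hWW]; simp only [Matrix.mul_assoc, Matrix.one_mul]
      _ = _ := by rw [diagonal_mul_diagonal]
  have hh : ∀ f : r → ℝ, (W * diagonal (fun i => (f i : ℂ)) * Wᴴ)ᴴ
      = W * diagonal (fun i => (f i : ℂ)) * Wᴴ := by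
    intro f
    rw [conjTranspose_mul, conjTranspose_mul, conjTranspose_conjTranspose, diagonal_conjTranspose,
      Matrix.mul_assoc]
    congr 3; ext i; simp
  set q : r → ℝ := fun i => Real.sqrt (Real.sqrt (d i)) with hq
  have hq0 : ∀ i, q i ≠ 0 := fun i => (Real.sqrt_pos.2 (Real.sqrt_pos.2 (hd0 i))).ne'
  have hq4 : ∀ i, q i * q i * (q i * q i) = d i := by
    intro i
    simp only [hq]
    rw [Real.mul_self_sqrt (Real.sqrt_nonneg _), Real.mul_self_sqrt (hd0 i).le]
  refine ⟨W * diagonal (fun i => (q i : ℂ)) * Wᴴ,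
    W * diagonal (fun i => (((q i)⁻¹ : ℝ) : ℂ)) * Wᴴ, hh q, hh _, ?_, ?_, ?_⟩
  · rw [hm]
    have : (fun i => (q i : ℂ) * (((q i)⁻¹ : ℝ) : ℂ)) = fun _ => 1 := by
      ext i; rw [← Complex.ofReal_mul, mul_inv_cancel₀ (hq0 i)]; simp
    rw [this, diagonal_one, Matrix.mul_one, hWW']
  · rw [hm]
    have : (fun i => (((q i)⁻¹ : ℝ) : ℂ) * (q i : ℂ)) = fun _ => 1 := by
      ext i; rw [← Complex.ofReal_mul, inv_mul_cancel₀ (hq0 i)]; simp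
    rw [this, diagonal_one, Matrix.mul_one, hWW']
  · rw [hm, hm, hs]
    congr 3; ext i
    rw [← hq4 i]; push_cast; rfl

lemma aux_ptrace_conj {m j r : Type} [Fintype m] [DecidableEq m] [Fintype j] [DecidableEq j]
    [Fintype r] (K : Matrix r r ℂ) (A : Matrix ((m × j) × r) ((m × j) × r) ℂ) :
    ptraceN (((1 : Matrix (m × j) (m × j) ℂ) ⊗ₖ K) * A * ((1 : Matrix (m × j) (m × j) ℂ) ⊗ₖ K))
      = K * ptraceN A * K := by
  ext a b
  have e1 : ptraceN (((1 : Matrix (m × j) (m × j) ℂ) ⊗ₖ K) * A * ((1 : Matrix (m × j) (m × j) ℂ) ⊗ₖ K)) a b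
      = ∑ x : m × j, ∑ c, ∑ d, (K a c * K d b) * A (x, c) (x, d) := by
    simp only [ptraceN, of_apply, aux_conj_apply]
  have e2 : (K * ptraceN A * K) a b
      = ∑ d, ∑ c, ∑ x : m × j, (K a c * K d b) * A (x, c) (x, d) := by
    simp only [ptraceN, of_apply, Matrix.mul_apply, Finset.sum_mul, Finset.mul_sum]
    exact Finset.sum_congr rfl fun d _ => Finset.sum_congr rfl fun c _ =>
      Finset.sum_congr rfl fun x _ => by ring
  rw [e1, e2, Finset.sum_comm]
  symm
  rw [Finset.sum_comm]
  refine Finset.sum_congr rfl fun c _ => ?_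
  rw [Finset.sum_comm]

lemma aux_ptrace_psd {m j r : Type} [Fintype m] [Fintype j] [Fintype r]
    (A : Matrix ((m × j) × r) ((m × j) × r) ℂ) (h : A.PosSemidef) : (ptraceN A).PosSemidef := by
  have : ptraceN A = ∑ x : m × j, A.submatrix (fun a => (x, a)) (fun a => (x, a)) := by
    ext a b; simp [ptraceN, Matrix.sum_apply]
  rw [this]
  exact Matrix.posSemidef_sum _ fun x _ => h.submatrix _

lemma aux_ptrace_trace {m j r : Type} [Fintype m] [Fintype j] [Fintype r]
    (A : Matrix ((m × j) × r) ((m × j) × r) ℂ) : (ptraceN A).trace = A.trace := by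
  simp only [ptraceN, Matrix.trace, Matrix.diag, of_apply]
  rw [Finset.sum_comm, ← Fintype.sum_prod_type']

lemma aux_ptrace_add_one {m j r : Type} [Fintype m] [DecidableEq m] [Fintype j] [DecidableEq j]
    [Fintype r] [DecidableEq r]
    (A : Matrix ((m × j) × r) ((m × j) × r) ℂ) (c : ℂ) :
    ptraceN (A + c • 1) = ptraceN A + ((Fintype.card (m × j) : ℂ) * c) • (1 : Matrix r r ℂ) := by
  ext a b
  simp only [ptraceN, of_apply, Matrix.add_apply, Matrix.smul_apply, Finset.sum_add_distrib,
    Matrix.one_apply, Prod.mk.injEq, true_and, Finset.sum_const, smul_eq_mul, Finset.card_univ,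
    nsmul_eq_mul, mul_assoc]

lemma aux_kron_U {n r : Type} [Fintype n] [Fintype r] [DecidableEq r]
    (U : Matrix n n ℂ) (A : Matrix (n × r) (n × r) ℂ) (x y : n × r) :
    ((U ⊗ₖ (1 : Matrix r r ℂ)) * A * (U ⊗ₖ (1 : Matrix r r ℂ))ᴴ) x y
      = (U * auxBlock A x.2 y.2 * Uᴴ) x.1 y.1 := by
  rw [conjTranspose_kronecker, conjTranspose_one]
  simp only [Matrix.mul_apply, Fintype.sum_prod_type, kroneckerMap_apply, Matrix.one_apply, ite_mul,
    mul_one, zero_mul, mul_ite, mul_zero, auxBlock, of_apply, 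
    Finset.sum_ite_eq, Finset.sum_ite_eq', Finset.mem_univ, if_true]

/-- the map `ψ - τ` -/
noncomputable def auxPhi {M J D : Type} [Fintype M] [DecidableEq M] [Fintype J]
    [Fintype D] [DecidableEq D] (U : D → Matrix (M × J) (M × J) ℂ) :
    Matrix (M × J) (M × J) ℂ →ₗ[ℂ] Matrix (M × D) (M × D) ℂ where
  toFun X := (Matrix.of fun (mi : M × D) (mi' : M × D) =>
          if mi.2 = mi'.2 then
            ((Fintype.card D : ℂ))⁻¹ * ∑ t : J, (U mi.2 * X * (U mi.2)ᴴ) (mi.1, t) (mi'.1, t)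
          else 0) - (Matrix.of fun (mi : M × D) (mi' : M × D) =>
          if mi = mi' then X.trace / ((Fintype.card M : ℂ) * (Fintype.card D : ℂ)) else 0)
  map_add' X Y := by
    ext p q
    simp only [Matrix.mul_add, Matrix.add_mul, Matrix.trace_add, Matrix.add_apply, Matrix.sub_apply,
      of_apply, Finset.sum_add_distrib]
    split_ifs <;> ring
  map_smul' c X := by
    ext p q
    simp only [Matrix.mul_smul, Matrix.smul_mul, Matrix.trace_smul, Matrix.smul_apply,
      Matrix.sub_apply, of_apply, smul_eq_mul, ← Finset.mul_sum, RingHom.id_apply]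
    split_ifs <;> ring

lemma aux_phi_hs {M J D : Type} [Fintype M] [DecidableEq M] [Fintype J] [DecidableEq J]
    [Fintype D] [DecidableEq D] [Nonempty M] [Nonempty D]
    (U : D → Matrix (M × J) (M × J) ℂ) (hU : ∀ i, U i ∈ Matrix.unitaryGroup (M × J) ℂ)
    (X : Matrix (M × J) (M × J) ℂ) :
    hsNormSq (auxPhi U X) = hsNormSq (Matrix.of fun (mi : M × D) (mi' : M × D) =>
          if mi.2 = mi'.2 then
            ((Fintype.card D : ℂ))⁻¹ * ∑ t : J, (U mi.2 * X * (U mi.2)ᴴ) (mi.1, t) (mi'.1, t)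
          else 0)
      - hsNormSq (Matrix.of fun (mi : M × D) (mi' : M × D) =>
          if mi = mi' then X.trace / ((Fintype.card M : ℂ) * (Fintype.card D : ℂ)) else 0) := by
  have hM : (Fintype.card M : ℂ) ≠ 0 := by simp
  have hD : (Fintype.card D : ℂ) ≠ 0 := by simp
  have h1 : (Matrix.of fun (mi : M × D) (mi' : M × D) =>
          if mi = mi' then X.trace / ((Fintype.card M : ℂ) * (Fintype.card D : ℂ)) else 0)
      = (X.trace / ((Fintype.card M : ℂ) * (Fintype.card D : ℂ))) • (1 : Matrix (M × D) (M × D) ℂ) := by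
    ext p q
    simp [Matrix.one_apply]
  have h2 : auxPhi U X = (Matrix.of fun (mi : M × D) (mi' : M × D) =>
          if mi.2 = mi'.2 then
            ((Fintype.card D : ℂ))⁻¹ * ∑ t : J, (U mi.2 * X * (U mi.2)ᴴ) (mi.1, t) (mi'.1, t)
          else 0) - (Matrix.of fun (mi : M × D) (mi' : M × D) =>
          if mi = mi' then X.trace / ((Fintype.card M : ℂ) * (Fintype.card D : ℂ)) else 0) := rfl
  rw [h2, h1]
  apply aux_hs_sub
  have h3 : ∀ i, ∑ m : M, ∑ t : J, (U i * X * (U i)ᴴ) (m, t) (m, t) = X.trace := by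
    intro i
    have h4 : (U i * X * (U i)ᴴ).trace = X.trace := by
      rw [Matrix.trace_mul_comm, ← Matrix.mul_assoc]
      have : (U i)ᴴ * U i = 1 := Matrix.mem_unitaryGroup_iff'.1 (hU i)
      rw [this, Matrix.one_mul]
    rw [← h4]
    simp only [Matrix.trace, Matrix.diag, Fintype.sum_prod_type]
  simp only [Matrix.trace, Matrix.diag, of_apply, if_true, Fintype.sum_prod_type]
  rw [Finset.sum_comm]
  simp only [← Finset.mul_sum, h3]
  rw [Finset.sum_const, Finset.card_univ, nsmul_eq_mul, Fintype.card_prod]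
  simp only [Matrix.trace, Matrix.diag, Fintype.sum_prod_type]
  push_cast
  field_simp

lemma aux_min {M J R : Type} [Fintype M] [DecidableEq M] [Fintype J] [DecidableEq J]
    [Fintype R] [DecidableEq R] (b : ℝ) (c : ℝ) (hc : 0 ≤ c)
    (ρ : Matrix ((M × J) × R) ((M × J) × R) ℂ) (hρ : ρ.PosSemidef)
    (hmin : ∀ E : Matrix ((M × J) × R) ((M × J) × R) ℂ, E.PosSemidef →
      ptraceN E = (1 : Matrix R R ℂ) → ((ρ * E).trace).re ≤ b)
    (T : Matrix R R ℂ) (hT : Tᴴ = T)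
    (h1 : (T * T) * ptraceN (ρ + (c : ℂ) • 1) * (T * T) = 1) :
    hsNormSq (((1 : Matrix (M × J) (M × J) ℂ) ⊗ₖ T) * ρ * ((1 : Matrix (M × J) (M × J) ℂ) ⊗ₖ T)) ≤ b := by
  set L := ((1 : Matrix (M × J) (M × J) ℂ) ⊗ₖ T) with hL
  set K := ((1 : Matrix (M × J) (M × J) ℂ) ⊗ₖ (T * T)) with hK
  have hLH : Lᴴ = L := by rw [hL, conjTranspose_kronecker, conjTranspose_one, hT]
  have hLL : L * L = K := by rw [hL, hK, ← mul_kronecker_mul, Matrix.one_mul]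
  have hKH : Kᴴ = K := by rw [← hLL, conjTranspose_mul, hLH]
  have hpsd : (ρ + (c : ℂ) • 1).PosSemidef :=
    hρ.add (Matrix.PosSemidef.one.smul (by exact_mod_cast hc))
  have h2 := hmin (K * (ρ + (c : ℂ) • 1) * K)
    (by have := hpsd.mul_mul_conjTranspose_same K; rwa [hKH] at this)
    (by rw [hK, aux_ptrace_conj, h1])
  have h3 : (ρ * (K * (ρ + (c : ℂ) • 1) * K)).trace
      = ((L * ρ * L)ᴴ * (L * ρ * L)).trace + (c : ℂ) * (K * ρ * Kᴴ).trace := by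
    rw [Matrix.mul_add, Matrix.add_mul, Matrix.mul_add, Matrix.trace_add]
    congr 1
    · rw [conjTranspose_mul, conjTranspose_mul, hLH, hρ.1.eq]
      rw [show L * (ρ * L) * (L * ρ * L) = (L * ρ * (L * L) * ρ) * L by simp only [Matrix.mul_assoc]]
      rw [Matrix.trace_mul_comm _ L, show L * (L * ρ * (L * L) * ρ) = (L * L) * (ρ * (L * L) * ρ) by
        simp only [Matrix.mul_assoc], hLL, Matrix.trace_mul_comm K]
      simp only [Matrix.mul_assoc]
    · rw [Matrix.mul_smul, Matrix.smul_mul, Matrix.mul_smul, Matrix.trace_smul, smul_eq_mul, hKH,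
        Matrix.mul_one, Matrix.trace_mul_comm (K * ρ), ← Matrix.mul_assoc K, Matrix.trace_mul_comm ρ]
  rw [h3, Complex.add_re, Complex.re_ofReal_mul] at h2
  have h4 := mul_nonneg hc (aux_psd_trace K ρ hρ)
  unfold hsNormSq
  linarith

/-- every (k,ε)-quantum spectral extractor is a decoupling (k,2√ε)-quantum
extractor.  Here `H_N = H_M ⊗ H_{N\M}`, the spectral condition
`λ_max(ψ†∘ψ − τ†∘τ) ≤ 2^k ε/(|M||D|)` is expressed through the Rayleigh quotient (w.r.t.
the Hilbert–Schmidt inner product), and `H_min(N|R)_ρ ≥ k` is expressed as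
`tr[ρ_{NR} E] ≤ 2^{−k}` for all `E ≥ 0` with `tr_N E = 1_R`. -/
theorem quantum_spectral_extractor_decoupling
    {M J D R : Type} [Fintype M] [DecidableEq M] [Fintype J] [DecidableEq J]
    [Fintype D] [DecidableEq D] [Fintype R] [DecidableEq R]
    [Nonempty M] [Nonempty J] [Nonempty D]
    (U : D → Matrix (M × J) (M × J) ℂ) (hU : ∀ i, U i ∈ Matrix.unitaryGroup (M × J) ℂ)
    (k ε : ℝ) (hε : 0 < ε)
    -- spectral condition for ψ(ρ) = (1/|D|) Σ_i tr_{N\M}[U^i ρ (U^i)†] ⊗ |i⟩⟨i| and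
    -- τ(ρ) = tr[ρ]·(1_M/|M|) ⊗ (1_D/|D|)
    (hspec : ∀ X : Matrix (M × J) (M × J) ℂ,
      hsNormSq (Matrix.of fun (mi : M × D) (mi' : M × D) =>
          if mi.2 = mi'.2 then
            ((Fintype.card D : ℂ))⁻¹ * ∑ t : J, (U mi.2 * X * (U mi.2)ᴴ) (mi.1, t) (mi'.1, t)
          else 0)
      - hsNormSq (Matrix.of fun (mi : M × D) (mi' : M × D) =>
          if mi = mi' then X.trace / ((Fintype.card M : ℂ) * (Fintype.card D : ℂ)) else 0)
      ≤ 2 ^ k * ε / (Fintype.card M * Fintype.card D) * hsNormSq X)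
    -- the input state ρ_{NR} with H_min(N|R)_ρ ≥ k
    (ρ : Matrix ((M × J) × R) ((M × J) × R) ℂ) (hρ : ρ.PosSemidef) (hρtr : ρ.trace = 1)
    (hmin : ∀ E : Matrix ((M × J) × R) ((M × J) × R) ℂ, E.PosSemidef →
      ptraceN E = (1 : Matrix R R ℂ) → ((ρ * E).trace).re ≤ 2 ^ (-k)) :
    -- decoupling: ‖(1/|D|) Σ_i tr_{N\M}[U^i ρ_{NR}(U^i)†] ⊗ |i⟩⟨i| − 1_M/|M| ⊗ ρ_R ⊗ 1_D/|D|‖₁ ≤ 2√ε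
    traceNorm
      ((Matrix.of fun (mia : (M × D) × R) (mjb : (M × D) × R) =>
          if mia.1.2 = mjb.1.2 then
            ((Fintype.card D : ℂ))⁻¹ * ∑ t : J,
              ((U mia.1.2 ⊗ₖ (1 : Matrix R R ℂ)) * ρ * (U mia.1.2 ⊗ₖ (1 : Matrix R R ℂ))ᴴ)
                ((mia.1.1, t), mia.2) ((mjb.1.1, t), mjb.2)
          else 0)
        - (Matrix.of fun (mia : (M × D) × R) (mjb : (M × D) × R) =>
          if mia.1 = mjb.1 then
            ((Fintype.card M * Fintype.card D : ℂ))⁻¹ * ptraceN ρ mia.2 mjb.2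
          else 0))
      ≤ 2 * Real.sqrt ε := by
  have hR : Nonempty R := by
    by_contra h
    rw [not_nonempty_iff] at h
    simp [Matrix.trace] at hρtr
  have hM0 : (0 : ℝ) < Fintype.card M := by exact_mod_cast Fintype.card_pos
  have hD0 : (0 : ℝ) < Fintype.card D := by exact_mod_cast Fintype.card_pos
  have hN0 : (0 : ℝ) < Fintype.card (M × J) := by exact_mod_cast Fintype.card_pos
  have hR0 : (0 : ℝ) < Fintype.card R := by exact_mod_cast Fintype.card_pos
  set c : ℝ := ((Fintype.card (M × J) : ℝ) * Fintype.card R)⁻¹ with hc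
  have hc0 : 0 < c := by positivity
  have hσ := aux_ptrace_add_one ρ (c : ℂ)
  have hσpd : (ptraceN (ρ + (c : ℂ) • 1)).PosDef := by
    rw [hσ]
    refine Matrix.PosDef.posSemidef_add (aux_ptrace_psd ρ hρ) (Matrix.PosDef.one.smul ?_)
    have : 0 < (Fintype.card (M × J) : ℝ) * c := by positivity
    exact_mod_cast this
  have hσtr : (ptraceN (ρ + (c : ℂ) • 1)).trace = 2 := by
    rw [aux_ptrace_trace, Matrix.trace_add, hρtr, Matrix.trace_smul, Matrix.trace_one,
      Fintype.card_prod (M × J) R]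
    have : c * ((Fintype.card (M × J) * Fintype.card R : ℕ) : ℝ) = 1 := by
      rw [hc]; push_cast; field_simp
    have h2 : (c : ℂ) * ((Fintype.card (M × J) * Fintype.card R : ℕ) : ℂ) = 1 := by
      exact_mod_cast this
    rw [smul_eq_mul, h2]; norm_num
  obtain ⟨S, T, hS, hT, hST, hTS, hS4⟩ := aux_root _ hσpd
  have hK : (T * T) * ptraceN (ρ + (c : ℂ) • 1) * (T * T) = 1 := by
    rw [← hS4]
    calc _ = T * (T * S) * S * S * (S * T) * T := by simp only [Matrix.mul_assoc]
      _ = (T * S) * (S * T) := by rw [hTS, hST]; simp only [Matrix.mul_assoc, Matrix.mul_one, hTS, hST]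
      _ = 1 := by rw [hTS, hST, Matrix.one_mul]
  have hb := aux_min (2 ^ (-k)) c hc0.le ρ hρ hmin T hT hK
  set ρ' := ((1 : Matrix (M × J) (M × J) ℂ) ⊗ₖ T) * ρ * ((1 : Matrix (M × J) (M × J) ℂ) ⊗ₖ T) with hρ'
  have hρρ' : ρ = ((1 : Matrix (M × J) (M × J) ℂ) ⊗ₖ S) * ρ' * ((1 : Matrix (M × J) (M × J) ℂ) ⊗ₖ S) := by
    have i1 : ((1 : Matrix (M × J) (M × J) ℂ) ⊗ₖ S) * ((1 : Matrix (M × J) (M × J) ℂ) ⊗ₖ T) = 1 := by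
      rw [← mul_kronecker_mul, Matrix.one_mul, hST, one_kronecker_one]
    have i2 : ((1 : Matrix (M × J) (M × J) ℂ) ⊗ₖ T) * ((1 : Matrix (M × J) (M × J) ℂ) ⊗ₖ S) = 1 := by
      rw [← mul_kronecker_mul, Matrix.one_mul, hTS, one_kronecker_one]
    rw [hρ', ← Matrix.mul_assoc, ← Matrix.mul_assoc, i1, Matrix.one_mul, Matrix.mul_assoc, i2,
      Matrix.mul_one]
  have hA : ((Matrix.of fun (mia : (M × D) × R) (mjb : (M × D) × R) =>
          if mia.1.2 = mjb.1.2 then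
            ((Fintype.card D : ℂ))⁻¹ * ∑ t : J,
              ((U mia.1.2 ⊗ₖ (1 : Matrix R R ℂ)) * ρ * (U mia.1.2 ⊗ₖ (1 : Matrix R R ℂ))ᴴ)
                ((mia.1.1, t), mia.2) ((mjb.1.1, t), mjb.2)
          else 0)
        - (Matrix.of fun (mia : (M × D) × R) (mjb : (M × D) × R) =>
          if mia.1 = mjb.1 then
            ((Fintype.card M * Fintype.card D : ℂ))⁻¹ * ptraceN ρ mia.2 mjb.2
          else 0)) = auxExt (auxPhi U) ρ := by
    ext p q
    simp only [Matrix.sub_apply, of_apply, aux_kron_U, auxExt, auxPhi, LinearMap.coe_mk,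
      AddHom.coe_mk]
    congr 1
    refine if_congr Iff.rfl ?_ rfl
    rw [div_eq_inv_mul]
    rfl
  rw [hA]
  have hB := aux_hs_ext (auxPhi U) (2 ^ k * ε / (Fintype.card M * Fintype.card D))
    (fun X => by rw [aux_phi_hs U hU]; exact hspec X) ρ'
  have hdec : auxExt (auxPhi U) ρ = ((1 : Matrix (M × D) (M × D) ℂ) ⊗ₖ S) * auxExt (auxPhi U) ρ'
      * ((1 : Matrix (M × D) (M × D) ℂ) ⊗ₖ S) := by
    rw [← aux_ext_conj, ← hρρ']
  have hfin := aux_traceNorm ((1 : Matrix (M × D) (M × D) ℂ) ⊗ₖ S) (auxExt (auxPhi U) ρ')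
    (by rw [conjTranspose_kronecker, conjTranspose_one, hS])
  rw [← hdec] at hfin
  have htr : ((((1 : Matrix (M × D) (M × D) ℂ) ⊗ₖ S) * ((1 : Matrix (M × D) (M × D) ℂ) ⊗ₖ S) *
      (((1 : Matrix (M × D) (M × D) ℂ) ⊗ₖ S) * ((1 : Matrix (M × D) (M × D) ℂ) ⊗ₖ S))).trace).re
      = Fintype.card M * Fintype.card D * 2 := by
    rw [← mul_kronecker_mul, ← mul_kronecker_mul, hS4, Matrix.trace_kronecker, hσtr, Matrix.one_mul,
      Matrix.one_mul, Matrix.trace_one, Fintype.card_prod]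
    have : (((Fintype.card M * Fintype.card D : ℕ) : ℂ) * 2)
      = ((Fintype.card M * Fintype.card D * 2 : ℝ) : ℂ) := by push_cast; rfl
    rw [this, Complex.ofReal_re]
  rw [htr] at hfin
  have hk : (2 : ℝ) ^ k * 2 ^ (-k) = 1 := by
    rw [← Real.rpow_add (by norm_num)]; simp
  have h5 : hsNormSq (auxExt (auxPhi U) ρ') ≤
      2 ^ k * ε / (Fintype.card M * Fintype.card D) * 2 ^ (-k) :=
    hB.trans (mul_le_mul_of_nonneg_left hb (by positivity))
  have h6 : traceNorm (auxExt (auxPhi U) ρ) ^ 2 ≤ 2 * ε := by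
    refine hfin.trans ((mul_le_mul_of_nonneg_left h5 (by positivity)).trans (le_of_eq ?_))
    calc _ = 2 * ε * ((2 : ℝ) ^ k * 2 ^ (-k)) := by field_simp
      _ = _ := by rw [hk, mul_one]
  refine aux_le_sq (h6.trans ?_) (by positivity)
  rw [mul_pow, Real.sq_sqrt hε.le]
  linarith
end
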